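/- Conformal invariance of the conformally coupled scalar Lagrangian up to an exact differential (Penrose): let n = 4, let g be a metric on U, β : U → ℝ smooth, ω : U → ℝ smooth, and set g̃_{μν} = e^{2ω} g_{μν} and β̃ = e^{−ω} β. Then √|det g̃| ( β̃² _g̃R + 6 g̃^{λκ} ∂_λβ̃ ∂_κβ̃ ) = √|det g| ( β² _gR + 6 g^{λκ} ∂_λβ ∂_κβ ) − 6 ∂_λ( √|det g| β² g^{λκ} ∂_κω ) on U, where _g̃R is the scalar curvature of g̃; in particular the Lagrangian density β² _gR + 6 ∂^λβ ∂_λβ times the metric volume factor is invariant under the conformal transformation (g, β) ↦ (e^{2ω}g, e^{−ω}β) up to an exact divergence. -/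

import Mathlib

noncomputable section

open scoped BigOperators

/-- Partial derivative `∂_μ f` of a real-valued function on `ℝⁿ`. -/
def pd {n : ℕ} (μ : Fin n) (f : (Fin n → ℝ) → ℝ) : (Fin n → ℝ) → ℝ :=
  fun x => fderiv ℝ f x (Pi.single μ 1)

/-- Partial derivative `∂_μ f` of a complex-valued function on `ℝⁿ`. -/
def pdC {n : ℕ} (μ : Fin n) (f : (Fin n → ℝ) → ℂ) : (Fin n → ℝ) → ℂ :=
  fun x => fderiv ℝ f x (Pi.single μ 1)

/-- Christoffel symbols `_gΓ^μ_{νλ}` of the metric `g` (with inverse `ginv`). -/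
def christoffel {n : ℕ} (g ginv : (Fin n → ℝ) → Fin n → Fin n → ℝ)
    (μ ν lam : Fin n) (x : Fin n → ℝ) : ℝ :=
  (1/2) * ∑ κ, ginv x μ κ *
    (pd ν (fun y => g y κ lam) x + pd lam (fun y => g y κ ν) x - pd κ (fun y => g y ν lam) x)

/-- Weylian affine connection `Γ^μ_{νλ}` of the Weylian metric `(g, φ)`:
`Γ^μ_{νλ} = _gΓ^μ_{νλ} + δ^μ_ν φ_λ + δ^μ_λ φ_ν − g_{νλ} φ^μ`. -/
def weylConn {n : ℕ} (g ginv : (Fin n → ℝ) → Fin n → Fin n → ℝ)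
    (φ : (Fin n → ℝ) → Fin n → ℝ) (μ ν lam : Fin n) (x : Fin n → ℝ) : ℝ :=
  christoffel g ginv μ ν lam x
    + (if ν = μ then φ x lam else 0) + (if lam = μ then φ x ν else 0)
    - g x ν lam * ∑ κ, ginv x μ κ * φ x κ

/-- Curvature tensor `R^μ_{νλκ}` of a family of connection coefficients `Γ`. -/
def curvOf {n : ℕ} (Γ : (Fin n → ℝ) → Fin n → Fin n → Fin n → ℝ)
    (μ ν lam κ : Fin n) (x : Fin n → ℝ) : ℝ :=
  pd lam (fun y => Γ y μ ν κ) x - pd κ (fun y => Γ y μ ν lam) x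
    + ∑ σ, Γ x μ lam σ * Γ x σ ν κ - ∑ σ, Γ x μ κ σ * Γ x σ ν lam

/-- Ricci tensor `R_{νκ} = R^μ_{νμκ}`. -/
def ricciOf {n : ℕ} (Γ : (Fin n → ℝ) → Fin n → Fin n → Fin n → ℝ)
    (ν κ : Fin n) (x : Fin n → ℝ) : ℝ :=
  ∑ μ, curvOf Γ μ ν μ κ x

/-- Scalar curvature `R = g^{νκ} R_{νκ}`. -/
def scalarOf {n : ℕ} (ginv : (Fin n → ℝ) → Fin n → Fin n → ℝ)
    (Γ : (Fin n → ℝ) → Fin n → Fin n → Fin n → ℝ) (x : Fin n → ℝ) : ℝ :=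
  ∑ ν, ∑ κ, ginv x ν κ * ricciOf Γ ν κ x

/-- Volume factor `√|det g|`. -/
def volFac {n : ℕ} (g : (Fin n → ℝ) → Fin n → Fin n → ℝ) (x : Fin n → ℝ) : ℝ :=
  Real.sqrt |Matrix.det (Matrix.of (g x))|

/-- Laplace–Beltrami operator `Δ_g f = (1/√|det g|) ∂_μ ( √|det g| g^{μν} ∂_ν f )`. -/
def laplaceBeltrami {n : ℕ} (g ginv : (Fin n → ℝ) → Fin n → Fin n → ℝ)
    (f : (Fin n → ℝ) → ℝ) (x : Fin n → ℝ) : ℝ :=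
  (volFac g x)⁻¹ * ∑ μ, pd μ (fun y => volFac g y * ∑ ν, ginv y μ ν * pd ν f y) x

/-- Minkowski matrix `η = diag(1, −1, −1, −1)`. -/
def etaM : Fin 4 → Fin 4 → ℝ :=
  fun μ ν => if μ = ν then (if μ = 0 then 1 else -1) else 0

section Algebra

variable {n : ℕ}

/-- Difference of the Levi-Civita connections of `e^{2ω} g` and `g`, where `w = dω` and `W` is the
gradient of `ω`. -/
def conformalShift (G : Fin n → Fin n → ℝ) (w W : Fin n → ℝ) (μ ν lam : Fin n) : ℝ :=
  (if ν = μ then w lam else 0) + (if lam = μ then w ν else 0) - G ν lam * W μ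

lemma sum_sum_sum_rotate (f : Fin n → Fin n → Fin n → ℝ) :
    ∑ ν, ∑ κ, ∑ σ, f ν κ σ = ∑ σ, ∑ ν, ∑ κ, f ν κ σ := by
  rw [Finset.sum_comm (f := fun σ ν : Fin n => ∑ κ, f ν κ σ)]
  exact Finset.sum_congr rfl fun ν _ => Finset.sum_comm

lemma conformalShift_symm {G : Fin n → Fin n → ℝ} (hG : ∀ μ ν, G μ ν = G ν μ)
    (w W : Fin n → ℝ) (μ ν lam : Fin n) :
    conformalShift G w W μ ν lam = conformalShift G w W μ lam ν := by
  simp only [conformalShift, hG lam ν]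
  ring

lemma sum_conformalShift_left {G : Fin n → Fin n → ℝ} (hG : ∀ μ ν, G μ ν = G ν μ)
    {w W : Fin n → ℝ} (hw : ∀ ν, ∑ μ, G ν μ * W μ = w ν) (σ : Fin n) :
    ∑ μ, conformalShift G w W μ μ σ = n * w σ := by
  have h := hw σ
  simp only [hG σ] at h
  simp [conformalShift, Finset.sum_add_distrib, Finset.sum_sub_distrib, h]

lemma contract_conformalShift {G H : Fin n → Fin n → ℝ} (hH : ∀ μ ν, H μ ν = H ν μ)
    (hHG : ∀ μ ν, ∑ κ, H μ κ * G κ ν = if μ = ν then (1 : ℝ) else 0)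
    (hG : ∀ μ ν, G μ ν = G ν μ)
    {w W : Fin n → ℝ} (hW : ∀ μ, ∑ κ, H μ κ * w κ = W μ) (σ : Fin n) :
    ∑ ν, ∑ κ, H ν κ * conformalShift G w W σ ν κ = (2 - n) * W σ := by
  have h1 : ∀ ν, ∑ κ, H ν κ * (G ν κ * W σ) = W σ := fun ν => by
    have := hHG ν ν
    simp only [if_true] at this
    simp_rw [hG ν, ← mul_assoc, ← Finset.sum_mul, this, one_mul]
  have h2 : ∑ ν, H ν σ * w ν = W σ := by
    rw [← hW]; exact Finset.sum_congr rfl fun ν _ => by rw [hH]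
  have h3 : ∑ ν, ∑ κ, H ν κ * (if ν = σ then w κ else 0) = W σ := by
    rw [Finset.sum_eq_single σ] <;> simp +contextual [hW]
  simp only [conformalShift, mul_add, mul_sub, Finset.sum_add_distrib, Finset.sum_sub_distrib, h1,
    h3]
  simp [h2]
  ring

/-- The contraction `H^{νκ} X^μ_{κσ} Y^σ_{νμ}` of two families of connection coefficients. -/
def crossTerm (H : Fin n → Fin n → ℝ) (X Y : Fin n → Fin n → Fin n → ℝ) : ℝ :=
  ∑ ν, ∑ κ, H ν κ * ∑ μ, ∑ σ, X μ κ σ * Y σ ν μ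

lemma crossTerm_comm {H : Fin n → Fin n → ℝ} (hH : ∀ μ ν, H μ ν = H ν μ)
    (X Y : Fin n → Fin n → Fin n → ℝ) : crossTerm H X Y = crossTerm H Y X := by
  unfold crossTerm
  rw [Finset.sum_comm]
  refine Finset.sum_congr rfl fun ν _ => Finset.sum_congr rfl fun κ _ => ?_
  rw [hH, Finset.sum_comm]
  simp only [mul_comm]

lemma crossTerm_add_left (H : Fin n → Fin n → ℝ) (X X' Y : Fin n → Fin n → Fin n → ℝ) :
    crossTerm H (fun a b c => X a b c + X' a b c) Y = crossTerm H X Y + crossTerm H X' Y := by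
  simp only [crossTerm, add_mul, mul_add, Finset.sum_add_distrib]

lemma crossTerm_add_right (H : Fin n → Fin n → ℝ) (X Y Y' : Fin n → Fin n → Fin n → ℝ) :
    crossTerm H X (fun a b c => Y a b c + Y' a b c) = crossTerm H X Y + crossTerm H X Y' := by
  simp only [crossTerm, mul_add, Finset.sum_add_distrib]

lemma crossTerm_conformalShift {G H : Fin n → Fin n → ℝ} (hH : ∀ μ ν, H μ ν = H ν μ)
    (hHG : ∀ μ ν, ∑ κ, H μ κ * G κ ν = if μ = ν then (1 : ℝ) else 0)
    {w W : Fin n → ℝ} (hW : ∀ μ, ∑ κ, H μ κ * w κ = W μ)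
    {X : Fin n → Fin n → Fin n → ℝ} (hX : ∀ a b c, X a b c = X a c b) :
    crossTerm H X (conformalShift G w W) = ∑ μ, w μ * ∑ ν, ∑ κ, H ν κ * X μ ν κ := by
  have inner (ν κ : Fin n) : ∑ μ, ∑ σ, X μ κ σ * conformalShift G w W σ ν μ
      = ∑ μ, X μ κ ν * w μ + (∑ μ, X μ κ μ) * w ν - ∑ μ, ∑ σ, X μ κ σ * (G ν μ * W σ) := by
    simp only [conformalShift, mul_add, mul_sub, Finset.sum_add_distrib, Finset.sum_sub_distrib]
    simp [Finset.sum_mul]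
  have e1 : ∑ ν, ∑ κ, H ν κ * ∑ μ, X μ κ ν * w μ = ∑ μ, w μ * ∑ ν, ∑ κ, H ν κ * X μ ν κ := by
    have (ν κ : Fin n) : H ν κ * ∑ μ, X μ κ ν * w μ = ∑ μ, w μ * (H ν κ * X μ ν κ) := by
      rw [Finset.mul_sum]
      exact Finset.sum_congr rfl fun μ _ => by rw [hX]; ring
    simp only [this, Finset.mul_sum]
    rw [sum_sum_sum_rotate]
  have e2 : ∑ ν, ∑ κ, H ν κ * ((∑ μ, X μ κ μ) * w ν) = ∑ κ, (∑ μ, X μ κ μ) * W κ := by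
    rw [Finset.sum_comm]
    refine Finset.sum_congr rfl fun κ _ => ?_
    rw [← hW, Finset.mul_sum]
    exact Finset.sum_congr rfl fun ν _ => by rw [hH]; ring
  have e3 : ∑ ν, ∑ κ, H ν κ * ∑ μ, ∑ σ, X μ κ σ * (G ν μ * W σ) = ∑ κ, (∑ μ, X μ κ μ) * W κ := by
    have (κ : Fin n) : ∑ ν, H ν κ * ∑ μ, ∑ σ, X μ κ σ * (G ν μ * W σ) = ∑ σ, X κ κ σ * W σ := by
      have : ∑ ν, H ν κ * ∑ μ, ∑ σ, X μ κ σ * (G ν μ * W σ)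
          = ∑ μ, (∑ ν, H κ ν * G ν μ) * ∑ σ, X μ κ σ * W σ := by
        simp only [Finset.mul_sum, Finset.sum_mul]
        rw [Finset.sum_comm]
        refine Finset.sum_congr rfl fun μ _ => ?_
        rw [Finset.sum_comm]
        refine Finset.sum_congr rfl fun σ _ => Finset.sum_congr rfl fun ν _ => ?_
        rw [hH]; ring
      simp [this, hHG]
    rw [Finset.sum_comm]
    simp only [this, Finset.sum_mul]
    rw [Finset.sum_comm]
    refine Finset.sum_congr rfl fun μ _ => Finset.sum_congr rfl fun σ _ => by rw [hX]
  simp only [crossTerm, inner, mul_add, mul_sub, Finset.sum_add_distrib, Finset.sum_sub_distrib, e1, e2, e3]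
  ring

/-- The part of the scalar curvature that is quadratic in the connection coefficients. -/
def quadPart (H : Fin n → Fin n → ℝ) (X : Fin n → Fin n → Fin n → ℝ) : ℝ :=
  ∑ ν, ∑ κ, H ν κ * ∑ μ, (∑ σ, X μ μ σ * X σ ν κ - ∑ σ, X μ κ σ * X σ ν μ)

lemma quadPart_eq (H : Fin n → Fin n → ℝ) (X : Fin n → Fin n → Fin n → ℝ) :
    quadPart H X = ∑ σ, (∑ μ, X μ μ σ) * (∑ ν, ∑ κ, H ν κ * X σ ν κ) - crossTerm H X X := by
  simp only [quadPart, crossTerm, Finset.sum_sub_distrib, mul_sub]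
  congr 1
  have (ν κ : Fin n) : H ν κ * ∑ μ, ∑ σ, X μ μ σ * X σ ν κ
      = ∑ σ, (∑ μ, X μ μ σ) * (H ν κ * X σ ν κ) := by
    rw [Finset.sum_comm, Finset.mul_sum]
    refine Finset.sum_congr rfl fun σ _ => ?_
    rw [← Finset.sum_mul]
    ring
  simp only [this, Finset.mul_sum]
  rw [sum_sum_sum_rotate]

lemma quadPart_conformalShift {G H : Fin n → Fin n → ℝ} (hH : ∀ μ ν, H μ ν = H ν μ)
    (hHG : ∀ μ ν, ∑ κ, H μ κ * G κ ν = if μ = ν then (1 : ℝ) else 0)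
    (hG : ∀ μ ν, G μ ν = G ν μ)
    {w W : Fin n → ℝ} (hW : ∀ μ, ∑ κ, H μ κ * w κ = W μ) (hw : ∀ ν, ∑ μ, G ν μ * W μ = w ν)
    {X : Fin n → Fin n → Fin n → ℝ} (hX : ∀ a b c, X a b c = X a c b) :
    quadPart H (fun a b c => X a b c + conformalShift G w W a b c)
      = quadPart H X + (2 - n) * ∑ σ, (∑ μ, X μ μ σ) * W σ
        + (n - 2) * ∑ σ, w σ * ∑ ν, ∑ κ, H ν κ * X σ ν κ
        + (n - 1) * (2 - n) * ∑ σ, w σ * W σ := by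
  rw [quadPart_eq, quadPart_eq, crossTerm_add_left, crossTerm_add_right, crossTerm_add_right,
    crossTerm_comm hH (conformalShift G w W) X, crossTerm_conformalShift hH hHG hW hX,
    crossTerm_conformalShift hH hHG hW (conformalShift_symm hG w W)]
  simp only [mul_add, Finset.sum_add_distrib, sum_conformalShift_left hG hw,
    contract_conformalShift hH hHG hG hW]
  have key (t b : Fin n → ℝ) : ∑ σ, (t σ + n * w σ) * b σ + ∑ σ, (t σ + n * w σ) * ((2 - n) * W σ)
      = ∑ σ, t σ * b σ + (2 - n) * ∑ σ, t σ * W σ + n * ∑ σ, w σ * b σ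
        + n * (2 - n) * ∑ σ, w σ * W σ := by
    simp only [Finset.mul_sum, ← Finset.sum_add_distrib]
    exact Finset.sum_congr rfl fun σ _ => by ring
  have key' : ∑ σ, w σ * ((2 - n) * W σ) = (2 - n) * ∑ σ, w σ * W σ := by
    rw [Finset.mul_sum]
    exact Finset.sum_congr rfl fun σ _ => by ring
  rw [key, key']
  ring

lemma trace_of_christoffel {H : Fin n → Fin n → ℝ} (hH : ∀ μ ν, H μ ν = H ν μ)
    {d : Fin n → Fin n → Fin n → ℝ} (hd : ∀ a b c, d a b c = d a c b)
    {X : Fin n → Fin n → Fin n → ℝ}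
    (hX : ∀ a b c, X a b c = (1/2) * ∑ κ, H a κ * (d b κ c + d c κ b - d κ b c)) (σ : Fin n) :
    2 * ∑ μ, X μ μ σ = ∑ μ, ∑ κ, H μ κ * d σ μ κ := by
  have h : ∑ μ, ∑ κ, H μ κ * d μ κ σ = ∑ μ, ∑ κ, H μ κ * d κ μ σ := by
    rw [Finset.sum_comm]
    exact Finset.sum_congr rfl fun μ _ => Finset.sum_congr rfl fun κ _ => by rw [hH]
  simp only [hX, mul_add, mul_sub, Finset.sum_add_distrib, Finset.sum_sub_distrib,
    ← Finset.mul_sum, h, hd σ]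
  rw [Finset.sum_comm]
  simp only [hH]
  ring_nf

lemma contract_of_christoffel {H : Fin n → Fin n → ℝ} (hH : ∀ μ ν, H μ ν = H ν μ)
    {d : Fin n → Fin n → Fin n → ℝ} (hd : ∀ a b c, d a b c = d a c b)
    {X : Fin n → Fin n → Fin n → ℝ}
    (hX : ∀ a b c, X a b c = (1/2) * ∑ κ, H a κ * (d b κ c + d c κ b - d κ b c))
    {w W : Fin n → ℝ} (hW : ∀ μ, ∑ κ, H μ κ * w κ = W μ) :
    ∑ ν, ∑ κ, H ν κ * ∑ μ, d ν κ μ * W μ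
      = ∑ σ, w σ * (∑ ν, ∑ κ, H ν κ * X σ ν κ) + ∑ σ, (∑ μ, X μ μ σ) * W σ := by
  have e1 : ∑ σ, (∑ μ, X μ μ σ) * W σ
      = (1/2) * ∑ ν, ∑ κ, H ν κ * ∑ μ, d μ ν κ * W μ := by
    have (σ : Fin n) : (∑ μ, X μ μ σ) * W σ
        = (1/2) * ∑ ν, ∑ κ, H ν κ * d σ ν κ * W σ := by
      have := trace_of_christoffel hH hd hX σ
      simp only [← Finset.sum_mul, ← this]
      ring
    simp only [this, ← Finset.mul_sum]
    rw [← sum_sum_sum_rotate]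
    simp only [Finset.mul_sum, mul_assoc]
  have e2 : ∑ σ, w σ * (∑ ν, ∑ κ, H ν κ * X σ ν κ)
      = (1/2) * ∑ ν, ∑ κ, H ν κ * ∑ μ, (d ν μ κ + d κ μ ν - d μ ν κ) * W μ := by
    simp only [Finset.mul_sum]
    rw [← sum_sum_sum_rotate]
    refine Finset.sum_congr rfl fun ν _ => Finset.sum_congr rfl fun κ _ => ?_
    simp only [hX, ← hW, Finset.mul_sum]
    rw [Finset.sum_comm]
    refine Finset.sum_congr rfl fun μ _ => Finset.sum_congr rfl fun σ _ => ?_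
    rw [hH σ μ]
    ring
  have e3 : ∑ ν, ∑ κ, H ν κ * ∑ μ, d κ ν μ * W μ = ∑ ν, ∑ κ, H ν κ * ∑ μ, d ν κ μ * W μ := by
    rw [Finset.sum_comm]
    exact Finset.sum_congr rfl fun ν _ => Finset.sum_congr rfl fun κ _ => by rw [hH]
  have e4 (ν κ : Fin n) : ∑ μ, (d ν μ κ + d κ μ ν - d μ ν κ) * W μ
      = ∑ μ, d ν κ μ * W μ + ∑ μ, d κ ν μ * W μ - ∑ μ, d μ ν κ * W μ := by
    simp only [← Finset.sum_add_distrib, ← Finset.sum_sub_distrib]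
    exact Finset.sum_congr rfl fun μ _ => by rw [hd ν μ, hd κ μ]; ring
  rw [e1, e2]
  simp only [e4, Finset.sum_add_distrib, Finset.sum_sub_distrib, mul_add, mul_sub, e3]
  ring

end Algebra

section PartialDerivative

variable {n : ℕ} {f h : (Fin n → ℝ) → ℝ} {x : Fin n → ℝ}

lemma pd_congr (hfh : f =ᶠ[nhds x] h) (μ : Fin n) : pd μ f x = pd μ h x := by
  simp only [pd, hfh.fderiv_eq]

lemma pd_add (hf : DifferentiableAt ℝ f x) (hh : DifferentiableAt ℝ h x) (μ : Fin n) :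
    pd μ (fun y => f y + h y) x = pd μ f x + pd μ h x := by
  simp [pd, fderiv_fun_add hf hh]

lemma pd_sub (hf : DifferentiableAt ℝ f x) (hh : DifferentiableAt ℝ h x) (μ : Fin n) :
    pd μ (fun y => f y - h y) x = pd μ f x - pd μ h x := by
  simp [pd, fderiv_fun_sub hf hh]

lemma pd_mul (hf : DifferentiableAt ℝ f x) (hh : DifferentiableAt ℝ h x) (μ : Fin n) :
    pd μ (fun y => f y * h y) x = pd μ f x * h x + f x * pd μ h x := by
  simp [pd, fderiv_fun_mul hf hh]
  ring

lemma pd_sum {ι : Type*} (s : Finset ι) {F : ι → (Fin n → ℝ) → ℝ}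
    (hF : ∀ i ∈ s, DifferentiableAt ℝ (F i) x) (μ : Fin n) :
    pd μ (fun y => ∑ i ∈ s, F i y) x = ∑ i ∈ s, pd μ (F i) x := by
  simp [pd, fderiv_fun_sum hF]

lemma pd_comp {φ : ℝ → ℝ} {φ' : ℝ} (hφ : HasDerivAt φ φ' (f x)) (hf : DifferentiableAt ℝ f x)
    (μ : Fin n) : pd μ (fun y => φ (f y)) x = φ' * pd μ f x := by
  have := (hφ.comp_hasFDerivAt x hf.hasFDerivAt).fderiv
  simp only [pd]
  rw [show (fun y => φ (f y)) = φ ∘ f from rfl, this]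
  simp

lemma pd_exp_mul {u : (Fin n → ℝ) → ℝ} (hu : DifferentiableAt ℝ u x)
    (hf : DifferentiableAt ℝ f x) (c : ℝ) (μ : Fin n) :
    pd μ (fun y => Real.exp (c * u y) * f y) x
      = Real.exp (c * u x) * (c * pd μ u x * f x + pd μ f x) := by
  have h1 : HasDerivAt (fun t => Real.exp (c * t)) (Real.exp (c * u x) * c) (u x) := by
    simpa using ((hasDerivAt_id (u x)).const_mul c).exp
  rw [pd_mul (by fun_prop) hf, pd_comp h1 hu]
  ring

lemma ContDiffAt.pd (hf : ContDiffAt ℝ (⊤ : ℕ∞) f x) (μ : Fin n) :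
    ContDiffAt ℝ (⊤ : ℕ∞) (pd μ f) x :=
  (hf.fderiv_right (m := (⊤ : ℕ∞)) le_rfl).clm_apply contDiffAt_const

end PartialDerivative

section Determinant

variable {n : ℕ} {g : (Fin n → ℝ) → Fin n → Fin n → ℝ} {x : Fin n → ℝ}

/-- Jacobi's formula. -/
lemma pd_det (hg : ∀ μ ν, DifferentiableAt ℝ (fun y => g y μ ν) x) {H : Fin n → Fin n → ℝ}
    (hgH : ∀ μ ν, ∑ κ, g x μ κ * H κ ν = if μ = ν then (1 : ℝ) else 0) (σ : Fin n) :
    pd σ (fun y => Matrix.det (Matrix.of (g y))) x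
      = Matrix.det (Matrix.of (g x)) * ∑ μ, ∑ κ, H κ μ * pd σ (fun y => g y μ κ) x := by
  set A : Matrix (Fin n) (Fin n) ℝ := Matrix.of (g x) with hA
  have hinv : A⁻¹ = Matrix.of H := Matrix.inv_eq_right_inv (by
    ext μ ν
    simp [hA, Matrix.mul_apply, Matrix.one_apply, hgH])
  have hdet : IsUnit A.det := by
    refine Matrix.isUnit_det_of_right_inverse (B := Matrix.of H) ?_
    ext μ ν
    simp [hA, Matrix.mul_apply, Matrix.one_apply, hgH]
  have hadj : A.adjugate = A.det • Matrix.of H := by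
    rw [← hinv, Matrix.inv_def, smul_smul, Ring.mul_inverse_cancel _ hdet, one_smul]
  let D : ContinuousMultilinearMap ℝ (fun _ : Fin n => Fin n → ℝ) ℝ :=
    ⟨(Matrix.detRowAlternating (R := ℝ) (n := Fin n)).toMultilinearMap,
      continuous_id.matrix_det⟩
  have hg' : HasFDerivAt g
      (ContinuousLinearMap.pi fun μ => ContinuousLinearMap.pi fun ν =>
        fderiv ℝ (fun y => g y μ ν) x) x :=
    hasFDerivAt_pi.2 fun μ => hasFDerivAt_pi.2 fun ν => (hg μ ν).hasFDerivAt
  have hD := ((D.hasFDerivAt (g x)).comp x hg').fderiv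
  have hrow (μ : Fin n) (b : Fin n → ℝ) :
      D (Function.update (g x) μ b) = A.det * ∑ κ, H κ μ * b κ := by
    change (A.updateRow μ b).det = _
    rw [← Matrix.cramer_transpose_apply, Matrix.cramer_eq_adjugate_mulVec,
      ← Matrix.adjugate_transpose, hadj]
    simp [Matrix.mulVec, dotProduct, Finset.mul_sum, mul_assoc]
  change fderiv ℝ (D ∘ g) x _ = _
  rw [hD]
  simp only [ContinuousLinearMap.comp_apply, ContinuousMultilinearMap.linearDeriv_apply, hrow,
    Finset.mul_sum, ContinuousLinearMap.pi_apply, pd]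

lemma pd_volFac (hg : ∀ μ ν, DifferentiableAt ℝ (fun y => g y μ ν) x) {H : Fin n → Fin n → ℝ}
    (hgH : ∀ μ ν, ∑ κ, g x μ κ * H κ ν = if μ = ν then (1 : ℝ) else 0) (σ : Fin n) :
    DifferentiableAt ℝ (volFac g) x ∧
    2 * pd σ (volFac g) x
      = volFac g x * ∑ μ, ∑ κ, H κ μ * pd σ (fun y => g y μ κ) x := by
  set t := ∑ μ, ∑ κ, H κ μ * pd σ (fun y => g y μ κ) x with ht
  have hdet : Matrix.det (Matrix.of (g x)) ≠ 0 := by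
    refine (Matrix.isUnit_det_of_right_inverse (B := Matrix.of H) ?_).ne_zero
    ext μ ν
    simp [Matrix.mul_apply, Matrix.one_apply, hgH]
  have hdiff : DifferentiableAt ℝ (fun y => Matrix.det (Matrix.of (g y))) x := by
    simp only [Matrix.det_apply, Matrix.of_apply]
    fun_prop
  have habs := (hasDerivAt_abs hdet).sqrt (abs_ne_zero.2 hdet)
  refine ⟨DifferentiableAt.comp (g := fun s => √|s|)
    (f := fun y => Matrix.det (Matrix.of (g y))) x habs.differentiableAt hdiff, ?_⟩
  change 2 * pd σ (fun y => √|Matrix.det (Matrix.of (g y))|) x = √|Matrix.det (Matrix.of (g x))| * t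
  rw [pd_comp (φ := fun s => √|s|) habs hdiff, pd_det hg hgH, ← ht]
  have hpos : 0 < √|Matrix.det (Matrix.of (g x))| := Real.sqrt_pos.2 (abs_pos.2 hdet)
  have hsq := Real.mul_self_sqrt (abs_nonneg (Matrix.det (Matrix.of (g x))))
  have hsign := sign_mul_self (Matrix.det (Matrix.of (g x)))
  field_simp
  linear_combination t * hsign - t * hsq

lemma volFac_conformal {g gt : (Fin 4 → ℝ) → Fin 4 → Fin 4 → ℝ} {x : Fin 4 → ℝ} {s : ℝ}
    (h : ∀ μ ν, gt x μ ν = Real.exp (2 * s) * g x μ ν) :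
    volFac gt x = Real.exp (4 * s) * volFac g x := by
  have : Matrix.of (gt x) = Real.exp (2 * s) • Matrix.of (g x) := by
    ext μ ν
    simp [h]
  have hexp : Real.exp (2 * s) ^ 4 = Real.exp (4 * s) ^ 2 := by
    rw [← Real.exp_nat_mul, ← Real.exp_nat_mul]
    congr 1
    push_cast
    ring
  rw [volFac, volFac, this, Matrix.det_smul, Fintype.card_fin, hexp, abs_mul, abs_sq,
    Real.sqrt_mul (sq_nonneg _), Real.sqrt_sq (Real.exp_nonneg _)]

end Determinant

section Curvature

open Filter Topology

variable {n : ℕ} {x : Fin n → ℝ}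

lemma scalarOf_congr {Γ Γ' : (Fin n → ℝ) → Fin n → Fin n → Fin n → ℝ}
    (h : ∀ᶠ y in 𝓝 x, ∀ a b c, Γ y a b c = Γ' y a b c)
    (ginv : (Fin n → ℝ) → Fin n → Fin n → ℝ) :
    scalarOf ginv Γ x = scalarOf ginv Γ' x := by
  have h1 (a b c lam) : pd lam (fun y => Γ y a b c) x = pd lam (fun y => Γ' y a b c) x :=
    pd_congr (h.mono fun y hy => hy a b c) lam
  simp only [scalarOf, ricciOf, curvOf, h1, h.self_of_nhds]

lemma scalarOf_smul {ginv gtinv : (Fin n → ℝ) → Fin n → Fin n → ℝ} {c : ℝ}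
    (h : ∀ μ ν, gtinv x μ ν = c * ginv x μ ν)
    (Γ : (Fin n → ℝ) → Fin n → Fin n → Fin n → ℝ) :
    scalarOf gtinv Γ x = c * scalarOf ginv Γ x := by
  simp only [scalarOf, h, mul_assoc, Finset.mul_sum]

/-- The part of the scalar curvature that is linear in the derivatives of the connection. -/
def derivPart (H : Fin n → Fin n → ℝ) (Γ : (Fin n → ℝ) → Fin n → Fin n → Fin n → ℝ)
    (x : Fin n → ℝ) : ℝ :=
  ∑ ν, ∑ κ, H ν κ * ∑ μ, (pd μ (fun y => Γ y μ ν κ) x - pd κ (fun y => Γ y μ ν μ) x)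

lemma scalarOf_eq (ginv : (Fin n → ℝ) → Fin n → Fin n → ℝ)
    (Γ : (Fin n → ℝ) → Fin n → Fin n → Fin n → ℝ) (x : Fin n → ℝ) :
    scalarOf ginv Γ x = derivPart (ginv x) Γ x + quadPart (ginv x) (Γ x) := by
  simp only [scalarOf, ricciOf, curvOf, derivPart, quadPart, add_sub_assoc,
    Finset.sum_add_distrib, mul_add]

lemma derivPart_add (H : Fin n → Fin n → ℝ) {Γ Γ' : (Fin n → ℝ) → Fin n → Fin n → Fin n → ℝ}
    (hΓ : ∀ a b c, DifferentiableAt ℝ (fun y => Γ y a b c) x)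
    (hΓ' : ∀ a b c, DifferentiableAt ℝ (fun y => Γ' y a b c) x) :
    derivPart H (fun y a b c => Γ y a b c + Γ' y a b c) x
      = derivPart H Γ x + derivPart H Γ' x := by
  simp only [derivPart, pd_add (hΓ _ _ _) (hΓ' _ _ _), ← Finset.sum_add_distrib, ← mul_add]
  refine Finset.sum_congr rfl fun ν _ => Finset.sum_congr rfl fun κ _ => ?_
  congr 1
  exact Finset.sum_congr rfl fun μ _ => by ring

lemma differentiableAt_conformalShift {g : (Fin n → ℝ) → Fin n → Fin n → ℝ}
    {w W : (Fin n → ℝ) → Fin n → ℝ} (hg : ∀ μ ν, DifferentiableAt ℝ (fun y => g y μ ν) x)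
    (hw : ∀ μ, DifferentiableAt ℝ (fun y => w y μ) x)
    (hW : ∀ μ, DifferentiableAt ℝ (fun y => W y μ) x) (a b c : Fin n) :
    DifferentiableAt ℝ (fun y => conformalShift (g y) (w y) (W y) a b c) x := by
  unfold conformalShift
  split_ifs <;> fun_prop

lemma pd_conformalShift {g : (Fin n → ℝ) → Fin n → Fin n → ℝ}
    {w W : (Fin n → ℝ) → Fin n → ℝ} (hg : ∀ μ ν, DifferentiableAt ℝ (fun y => g y μ ν) x)
    (hw : ∀ μ, DifferentiableAt ℝ (fun y => w y μ) x)
    (hW : ∀ μ, DifferentiableAt ℝ (fun y => W y μ) x) (s a b c : Fin n) :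
    pd s (fun y => conformalShift (g y) (w y) (W y) a b c) x
      = (if b = a then pd s (fun y => w y c) x else 0)
        + (if c = a then pd s (fun y => w y b) x else 0)
        - (pd s (fun y => g y b c) x * W x a + g x b c * pd s (fun y => W y a) x) := by
  have hz : pd s (fun _ => (0 : ℝ)) x = 0 := by simp [pd]
  unfold conformalShift
  rw [pd_sub _ (by fun_prop), pd_add, pd_mul (hg _ _) (hW _)]
  · split_ifs <;> simp [hz]
  all_goals split_ifs <;> fun_prop

lemma derivPart_conformalShift {g : (Fin n → ℝ) → Fin n → Fin n → ℝ}
    {w W : (Fin n → ℝ) → Fin n → ℝ} (hg : ∀ μ ν, DifferentiableAt ℝ (fun y => g y μ ν) x)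
    (hw : ∀ μ, DifferentiableAt ℝ (fun y => w y μ) x)
    (hW : ∀ μ, DifferentiableAt ℝ (fun y => W y μ) x)
    (hwW : ∀ᶠ y in 𝓝 x, ∀ ν, ∑ μ, g y ν μ * W y μ = w y ν)
    (hsym : ∀ μ ν, g x μ ν = g x ν μ)
    {H : Fin n → Fin n → ℝ} (hH : ∀ μ ν, H μ ν = H ν μ)
    (hHG : ∀ μ ν, ∑ κ, H μ κ * g x κ ν = if μ = ν then (1 : ℝ) else 0) :
    derivPart H (fun y => conformalShift (g y) (w y) (W y)) x
      = (2 - n) * (∑ ν, ∑ κ, H ν κ * ∑ μ, pd ν (fun y => g y κ μ) x * W x μ)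
        - (∑ ν, ∑ κ, H ν κ * ∑ μ, pd μ (fun y => g y ν κ) x * W x μ)
        + (2 - 2 * n) * ∑ μ, pd μ (fun y => W y μ) x := by
  have hpw (κ ν : Fin n) : pd κ (fun y => w y ν) x
      = ∑ μ, (pd κ (fun y => g y ν μ) x * W x μ + g x ν μ * pd κ (fun y => W y μ) x) := by
    rw [← pd_congr (hwW.mono fun y hy => hy ν), pd_sum _ fun μ _ => (hg ν μ).fun_mul (hW μ)]
    exact Finset.sum_congr rfl fun μ _ => pd_mul (hg _ _) (hW _) κ
  have hric (ν κ : Fin n) :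
      ∑ μ, (pd μ (fun y => conformalShift (g y) (w y) (W y) μ ν κ) x
          - pd κ (fun y => conformalShift (g y) (w y) (W y) μ ν μ) x)
        = pd ν (fun y => w y κ) x + (1 - n) * pd κ (fun y => w y ν) x
          - ∑ μ, pd μ (fun y => g y ν κ) x * W x μ - g x ν κ * ∑ μ, pd μ (fun y => W y μ) x := by
    simp only [pd_conformalShift hg hw hW]
    have := hpw κ ν
    simp only [Finset.sum_add_distrib, Finset.sum_sub_distrib] at this ⊢
    simp [← this, Finset.mul_sum]
    ring
  have hcomm : ∑ ν, ∑ κ, H ν κ * pd κ (fun y => w y ν) x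
      = ∑ ν, ∑ κ, H ν κ * pd ν (fun y => w y κ) x := by
    rw [Finset.sum_comm]
    exact Finset.sum_congr rfl fun ν _ => Finset.sum_congr rfl fun κ _ => by rw [hH]
  have htr : ∑ ν, ∑ κ, H ν κ * (g x ν κ * ∑ μ, pd μ (fun y => W y μ) x)
      = n * ∑ μ, pd μ (fun y => W y μ) x := by
    simp only [← mul_assoc, ← Finset.sum_mul]
    have (ν : Fin n) : ∑ κ, H ν κ * g x ν κ = 1 := by
      simp only [hsym ν, hHG, if_true]
    simp [this]
  have hdiv : ∑ ν, ∑ κ, H ν κ * pd ν (fun y => w y κ) x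
      = ∑ ν, ∑ κ, H ν κ * ∑ μ, pd ν (fun y => g y κ μ) x * W x μ
        + ∑ μ, pd μ (fun y => W y μ) x := by
    have (ν : Fin n) : ∑ κ, H ν κ * ∑ μ, g x κ μ * pd ν (fun y => W y μ) x
        = pd ν (fun y => W y ν) x := by
      simp only [Finset.mul_sum, ← mul_assoc]
      rw [Finset.sum_comm]
      simp [← Finset.sum_mul, hHG]
    simp only [hpw, Finset.sum_add_distrib, mul_add, this]
  simp only [derivPart, hric, mul_add, mul_sub, Finset.sum_add_distrib, Finset.sum_sub_distrib,
    htr, mul_left_comm _ (1 - (n : ℝ)), ← Finset.mul_sum, hcomm]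
  rw [hdiv]
  ring

lemma inverse_left {G H : Fin n → Fin n → ℝ}
    (hGH : ∀ μ ν, ∑ κ, G μ κ * H κ ν = if μ = ν then (1 : ℝ) else 0) (μ ν : Fin n) :
    ∑ κ, H μ κ * G κ ν = if μ = ν then (1 : ℝ) else 0 := by
  have h : Matrix.of G * Matrix.of H = 1 := by
    ext μ ν
    simp [Matrix.mul_apply, Matrix.one_apply, hGH]
  simpa [Matrix.mul_apply, Matrix.one_apply] using
    congrArg (fun M : Matrix (Fin n) (Fin n) ℝ => M μ ν) (mul_eq_one_comm.1 h)

lemma inverse_symm {G H : Fin n → Fin n → ℝ} (hG : ∀ μ ν, G μ ν = G ν μ)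
    (hGH : ∀ μ ν, ∑ κ, G μ κ * H κ ν = if μ = ν then (1 : ℝ) else 0) (μ ν : Fin n) :
    H μ ν = H ν μ := by
  have h : Matrix.of G * Matrix.of H = 1 := by
    ext μ ν
    simp [Matrix.mul_apply, Matrix.one_apply, hGH]
  have hs : (Matrix.of G).IsSymm := by
    ext μ ν
    simp [hG μ ν]
  have hi : (Matrix.of H).IsSymm := by
    rw [← Matrix.inv_eq_right_inv h]
    exact hs.inv
  exact hi.apply ν μ

lemma christoffel_symm {g ginv : (Fin n → ℝ) → Fin n → Fin n → ℝ}
    (hsym : ∀ᶠ y in 𝓝 x, ∀ μ ν, g y μ ν = g y ν μ) (a b c : Fin n) :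
    christoffel g ginv a b c x = christoffel g ginv a c b x := by
  have (κ : Fin n) : pd κ (fun y => g y b c) x = pd κ (fun y => g y c b) x :=
    pd_congr (hsym.mono fun y hy => hy b c) κ
  simp only [christoffel, this]
  congr 1
  exact Finset.sum_congr rfl fun κ _ => by ring

lemma christoffel_conformal {g ginv gt gtinv : (Fin n → ℝ) → Fin n → Fin n → ℝ}
    {ω : (Fin n → ℝ) → ℝ} (hg : ∀ μ ν, DifferentiableAt ℝ (fun y => g y μ ν) x)
    (hω : DifferentiableAt ℝ ω x)
    (hinv : ∀ μ ν, ∑ κ, ginv x μ κ * g x κ ν = if μ = ν then (1 : ℝ) else 0)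
    (hgt : ∀ y μ ν, gt y μ ν = Real.exp (2 * ω y) * g y μ ν)
    (hgtinv : ∀ y μ ν, gtinv y μ ν = Real.exp (-2 * ω y) * ginv y μ ν) (a b c : Fin n) :
    christoffel gt gtinv a b c x = christoffel g ginv a b c x
      + conformalShift (g x) (fun μ => pd μ ω x) (fun μ => ∑ κ, ginv x μ κ * pd κ ω x) a b c := by
  have hexp : Real.exp (-2 * ω x) * Real.exp (2 * ω x) = 1 := by
    rw [← Real.exp_add, neg_mul, neg_add_cancel, Real.exp_zero]
  have hterm (κ : Fin n) : gtinv x a κ * (pd b (fun y => gt y κ c) x + pd c (fun y => gt y κ b) x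
        - pd κ (fun y => gt y b c) x)
      = ginv x a κ * (pd b (fun y => g y κ c) x + pd c (fun y => g y κ b) x
          - pd κ (fun y => g y b c) x)
        + (2 * (ginv x a κ * g x κ c * pd b ω x) + 2 * (ginv x a κ * g x κ b * pd c ω x)
          - 2 * (g x b c * (ginv x a κ * pd κ ω x))) := by
    simp only [hgt, hgtinv, pd_exp_mul hω (hg _ _)]
    linear_combination (ginv x a κ * (2 * pd b ω x * g x κ c + pd b (fun y => g y κ c) x
      + (2 * pd c ω x * g x κ b + pd c (fun y => g y κ b) x)
      - (2 * pd κ ω x * g x b c + pd κ (fun y => g y b c) x))) * hexp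
  simp only [christoffel, hterm, conformalShift, Finset.sum_add_distrib, Finset.sum_sub_distrib,
    ← Finset.mul_sum, ← Finset.sum_mul, hinv, @eq_comm _ a]
  split_ifs <;> ring

/-- Transformation of the scalar curvature when the Levi-Civita connection of `g` is replaced by
that of a conformal metric, still contracted with `g`. -/
lemma scalarOf_conformalShift {U : Set (Fin n → ℝ)} (hU : IsOpen U) (hx : x ∈ U)
    {g ginv : (Fin n → ℝ) → Fin n → Fin n → ℝ}
    (hg : ∀ μ ν, ContDiffOn ℝ (⊤ : ℕ∞) (fun x => g x μ ν) U)
    (hginv : ∀ μ ν, ContDiffOn ℝ (⊤ : ℕ∞) (fun x => ginv x μ ν) U)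
    (hsym : ∀ x ∈ U, ∀ μ ν, g x μ ν = g x ν μ)
    (hinv : ∀ x ∈ U, ∀ μ ν, ∑ κ, g x μ κ * ginv x κ ν = if μ = ν then (1 : ℝ) else 0)
    {ω : (Fin n → ℝ) → ℝ} (hω : ContDiffOn ℝ (⊤ : ℕ∞) ω U)
    {W : (Fin n → ℝ) → Fin n → ℝ} (hW : ∀ y μ, W y μ = ∑ κ, ginv y μ κ * pd κ ω y) :
    scalarOf ginv (fun y a b c => christoffel g ginv a b c y
        + conformalShift (g y) (fun μ => pd μ ω y) (W y) a b c) x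
      = scalarOf ginv (fun y a b c => christoffel g ginv a b c y) x
        - (n - 1) * (2 * ∑ μ, pd μ (fun y => W y μ) x
          + ∑ μ, (∑ ν, ∑ κ, ginv x ν κ * pd μ (fun y => g y ν κ) x) * W x μ)
        - (n - 1) * (n - 2) * ∑ μ, pd μ ω x * W x μ := by
  have hUx := hU.mem_nhds hx
  have hgc (μ ν) : ContDiffAt ℝ (⊤ : ℕ∞) (fun y => g y μ ν) x := (hg μ ν).contDiffAt hUx
  have hic (μ ν) : ContDiffAt ℝ (⊤ : ℕ∞) (fun y => ginv y μ ν) x := (hginv μ ν).contDiffAt hUx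
  have hωc (μ) : ContDiffAt ℝ (⊤ : ℕ∞) (pd μ ω) x := (hω.contDiffAt hUx).pd μ
  have hWc (μ) : ContDiffAt ℝ (⊤ : ℕ∞) (fun y => W y μ) x := by
    simp only [hW]
    exact ContDiffAt.sum fun κ _ => (hic μ κ).mul (hωc κ)
  have hΓc (a b c) : ContDiffAt ℝ (⊤ : ℕ∞) (fun y => christoffel g ginv a b c y) x := by
    unfold christoffel
    exact contDiffAt_const.mul (ContDiffAt.sum fun κ _ =>
      (hic a κ).mul ((((hgc κ c).pd b).add ((hgc κ b).pd c)).sub ((hgc b c).pd κ)))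
  have hone : ((⊤ : ℕ∞) : WithTop ℕ∞) ≠ 0 := by simp
  have hgd (μ ν) := (hgc μ ν).differentiableAt hone
  have hωd (μ) := (hωc μ).differentiableAt hone
  have hWd (μ) := (hWc μ).differentiableAt hone
  have hΓd (a b c) := (hΓc a b c).differentiableAt hone
  have hH := inverse_symm (hsym x hx) (hinv x hx)
  have hHG := inverse_left (hinv x hx)
  have hwW (y) (hy : y ∈ U) (ν) : ∑ μ, g y ν μ * W y μ = pd ν ω y := by
    simp only [hW, Finset.mul_sum, ← mul_assoc]
    rw [Finset.sum_comm]
    simp [← Finset.sum_mul, hinv y hy]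
  have hsymx : ∀ᶠ y in 𝓝 x, ∀ μ ν, g y μ ν = g y ν μ := eventually_of_mem hUx hsym
  have hX := fun a b c => christoffel_symm (ginv := ginv) hsymx a b c
  have hd (a b c) : pd a (fun y => g y b c) x = pd a (fun y => g y c b) x :=
    pd_congr (hsymx.mono fun y hy => hy b c) a
  have hWx (μ) : ∑ κ, ginv x μ κ * pd κ ω x = W x μ := (hW x μ).symm
  have hcon := contract_of_christoffel hH hd
    (X := fun a b c => christoffel g ginv a b c x) (fun _ _ _ => rfl) hWx
  have htr (σ) := trace_of_christoffel hH hd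
    (X := fun a b c => christoffel g ginv a b c x) (fun _ _ _ => rfl) σ
  have hdW : ∑ ν, ∑ κ, ginv x ν κ * ∑ μ, pd μ (fun y => g y ν κ) x * W x μ
      = ∑ μ, (∑ ν, ∑ κ, ginv x ν κ * pd μ (fun y => g y ν κ) x) * W x μ := by
    simp only [Finset.mul_sum, Finset.sum_mul, ← mul_assoc]
    exact sum_sum_sum_rotate _
  have hdW' : ∑ μ, (∑ ν, ∑ κ, ginv x ν κ * pd μ (fun y => g y ν κ) x) * W x μ
      = 2 * ∑ σ, (∑ μ, christoffel g ginv μ μ σ x) * W x σ := by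
    rw [Finset.mul_sum]
    exact Finset.sum_congr rfl fun σ _ => by rw [← htr]; ring
  rw [scalarOf_eq, scalarOf_eq,
    derivPart_add _ hΓd fun a b c => differentiableAt_conformalShift hgd hωd hWd a b c,
    derivPart_conformalShift hgd hωd hWd (eventually_of_mem hUx hwW) (hsym x hx) hH hHG,
    quadPart_conformalShift hH hHG (hsym x hx) hWx (hwW x hx) hX, hcon, hdW, hdW']
  ring

end Curvature

/-- Conformal invariance of the conformally coupled scalar Lagrangian up to
an exact differential (Penrose), in dimension `n = 4`: with `g̃ = e^{2ω} g`, `β̃ = e^{−ω} β`,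
`√|det g̃| ( β̃² _g̃R + 6 g̃^{λκ} ∂_λβ̃ ∂_κβ̃ )
  = √|det g| ( β² _gR + 6 g^{λκ} ∂_λβ ∂_κβ ) − 6 ∂_λ( √|det g| β² g^{λκ} ∂_κω )` on `U`. -/
theorem penrose_conformal_invariance
    (U : Set (Fin 4 → ℝ)) (hU : IsOpen U) (hUne : U.Nonempty)
    (g ginv : (Fin 4 → ℝ) → Fin 4 → Fin 4 → ℝ)
    (hg : ∀ μ ν, ContDiffOn ℝ (⊤ : ℕ∞) (fun x => g x μ ν) U)
    (hginv : ∀ μ ν, ContDiffOn ℝ (⊤ : ℕ∞) (fun x => ginv x μ ν) U)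
    (hsym : ∀ x ∈ U, ∀ μ ν, g x μ ν = g x ν μ)
    (hinv : ∀ x ∈ U, ∀ μ ν, ∑ κ, g x μ κ * ginv x κ ν = if μ = ν then (1:ℝ) else 0)
    (β : (Fin 4 → ℝ) → ℝ) (hβ : ContDiffOn ℝ (⊤ : ℕ∞) β U)
    (ω : (Fin 4 → ℝ) → ℝ) (hω : ContDiffOn ℝ (⊤ : ℕ∞) ω U)
    (gt gtinv : (Fin 4 → ℝ) → Fin 4 → Fin 4 → ℝ)
    (βt : (Fin 4 → ℝ) → ℝ)
    (hgt : ∀ y μ ν, gt y μ ν = Real.exp (2 * ω y) * g y μ ν)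
    (hgtinv : ∀ y μ ν, gtinv y μ ν = Real.exp (-2 * ω y) * ginv y μ ν)
    (hβt : ∀ y, βt y = Real.exp (-ω y) * β y) :
    ∀ x ∈ U,
      volFac gt x * ((βt x) ^ 2 * scalarOf gtinv (fun y a b c => christoffel gt gtinv a b c y) x
            + 6 * ∑ lam, ∑ κ, gtinv x lam κ * pd lam βt x * pd κ βt x)
        = volFac g x * ((β x) ^ 2 * scalarOf ginv (fun y a b c => christoffel g ginv a b c y) x
              + 6 * ∑ lam, ∑ κ, ginv x lam κ * pd lam β x * pd κ β x)
          - 6 * ∑ lam, pd lam (fun y => volFac g y * (β y) ^ 2 * ∑ κ, ginv y lam κ * pd κ ω y) x := by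
  intro x hx
  have hUx := hU.mem_nhds hx
  have hone : ((⊤ : ℕ∞) : WithTop ℕ∞) ≠ 0 := by simp
  have hgd (y) (hy : y ∈ U) (μ ν) : DifferentiableAt ℝ (fun y => g y μ ν) y :=
    ((hg μ ν).contDiffAt (hU.mem_nhds hy)).differentiableAt hone
  have hωd (y) (hy : y ∈ U) : DifferentiableAt ℝ ω y :=
    (hω.contDiffAt (hU.mem_nhds hy)).differentiableAt hone
  have hβd : DifferentiableAt ℝ β x := (hβ.contDiffAt hUx).differentiableAt hone
  obtain ⟨W, hW⟩ : ∃ W : (Fin 4 → ℝ) → Fin 4 → ℝ,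
      ∀ y μ, W y μ = ∑ κ, ginv y μ κ * pd κ ω y := ⟨_, fun _ _ => rfl⟩
  have hWd (μ) : DifferentiableAt ℝ (fun y => W y μ) x := by
    simp only [hW]
    exact DifferentiableAt.fun_sum fun κ _ =>
      (((hginv μ κ).contDiffAt hUx).differentiableAt hone).fun_mul
        (((hω.contDiffAt hUx).pd κ).differentiableAt hone)
  have hH := inverse_symm (hsym x hx) (hinv x hx)
  have hR : scalarOf gtinv (fun y a b c => christoffel gt gtinv a b c y) x
      = Real.exp (-2 * ω x) * scalarOf ginv (fun y a b c => christoffel g ginv a b c y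
        + conformalShift (g y) (fun μ => pd μ ω y) (W y) a b c) x := by
    rw [← scalarOf_smul (hgtinv x)]
    refine scalarOf_congr (Filter.eventually_of_mem hUx fun y hy a b c => ?_) gtinv
    rw [christoffel_conformal (hgd y hy) (hωd y hy) (inverse_left (hinv y hy)) hgt hgtinv,
      ← funext (hW y)]
  rw [hR, scalarOf_conformalShift hU hx hg hginv hsym hinv hω hW, volFac_conformal (hgt x)]
  have hvol := fun σ => (pd_volFac (hgd x hx) (hinv x hx) σ).2
  have hvold := (pd_volFac (hgd x hx) (hinv x hx) 0).1
  have hβt' : βt = fun y => Real.exp (-1 * ω y) * β y := by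
    funext y
    rw [hβt, neg_one_mul]
  have hgrad : ∑ lam, ∑ κ, gtinv x lam κ * pd lam βt x * pd κ βt x
      = Real.exp (-2 * ω x) * Real.exp (-ω x) ^ 2 *
        (∑ lam, ∑ κ, ginv x lam κ * pd lam β x * pd κ β x
          - 2 * β x * ∑ μ, pd μ β x * W x μ + β x ^ 2 * ∑ μ, pd μ ω x * W x μ) := by
    have hswap : ∑ lam, ∑ κ, ginv x lam κ * pd lam ω x * pd κ β x
        = ∑ lam, ∑ κ, ginv x lam κ * pd lam β x * pd κ ω x := by
      rw [Finset.sum_comm]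
      exact Finset.sum_congr rfl fun μ _ => Finset.sum_congr rfl fun κ _ => by rw [hH]; ring
    have hpair (u : Fin 4 → ℝ) : ∑ μ, u μ * W x μ
        = ∑ lam, ∑ κ, ginv x lam κ * u lam * pd κ ω x := by
      simp only [hW, Finset.mul_sum]
      exact Finset.sum_congr rfl fun μ _ => Finset.sum_congr rfl fun κ _ => by ring
    have hsplit : ∑ lam, ∑ κ, ginv x lam κ * pd lam β x * pd κ β x
          - 2 * β x * ∑ μ, pd μ β x * W x μ + β x ^ 2 * ∑ μ, pd μ ω x * W x μ
        = ∑ lam, ∑ κ, ginv x lam κ * (pd lam β x - β x * pd lam ω x)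
            * (pd κ β x - β x * pd κ ω x) := by
      rw [two_mul, add_mul]
      nth_rewrite 1 [hpair, ← hswap]
      rw [hpair, hpair]
      simp only [Finset.mul_sum, ← Finset.sum_add_distrib, ← Finset.sum_sub_distrib]
      exact Finset.sum_congr rfl fun μ _ => Finset.sum_congr rfl fun κ _ => by ring
    have hpd (μ : Fin 4) : pd μ βt x = Real.exp (-ω x) * (pd μ β x - β x * pd μ ω x) := by
      rw [hβt', pd_exp_mul (hωd x hx) hβd, neg_one_mul]
      ring
    rw [hsplit]
    simp only [hpd, hgtinv, Finset.mul_sum]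
    exact Finset.sum_congr rfl fun μ _ => Finset.sum_congr rfl fun κ _ => by ring
  have hdiv : ∑ lam, pd lam (fun y => volFac g y * β y ^ 2 * ∑ κ, ginv y lam κ * pd κ ω y) x
      = volFac g x * (β x ^ 2 * (∑ μ, pd μ (fun y => W y μ) x
          + (1/2) * ∑ μ, (∑ ν, ∑ κ, ginv x ν κ * pd μ (fun y => g y ν κ) x) * W x μ)
        + 2 * β x * ∑ μ, pd μ β x * W x μ) := by
    simp only [← hW, Finset.mul_sum, ← Finset.sum_add_distrib]
    simp only [← Finset.mul_sum]
    rw [Finset.mul_sum]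
    refine Finset.sum_congr rfl fun μ _ => ?_
    have hvolμ : 2 * pd μ (volFac g) x
        = volFac g x * ∑ ν, ∑ κ, ginv x ν κ * pd μ (fun y => g y ν κ) x := by
      rw [hvol]
      simp only [hH]
    simp only [sq]
    rw [pd_mul (hvold.fun_mul (hβd.fun_mul hβd)) (hWd μ), pd_mul hvold (hβd.fun_mul hβd),
      pd_mul hβd hβd]
    linear_combination (1/2) * β x * β x * W x μ * hvolμ
  have hexp : Real.exp (4 * ω x) * Real.exp (-2 * ω x) * Real.exp (-ω x) ^ 2 = 1 := by
    rw [sq, ← Real.exp_add, ← Real.exp_add, ← Real.exp_add, ← Real.exp_zero]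
    congr 1
    ring
  rw [hgrad, hdiv, hβt]
  push_cast
  linear_combination (volFac g x * (β x ^ 2 *
      (scalarOf ginv (fun y a b c => christoffel g ginv a b c y) x
    - 3 * (2 * ∑ μ, pd μ (fun y => W y μ) x
          + ∑ μ, (∑ ν, ∑ κ, ginv x ν κ * pd μ (fun y => g y ν κ) x) * W x μ)
        - 6 * ∑ μ, pd μ ω x * W x μ)
    + 6 * (∑ lam, ∑ κ, ginv x lam κ * pd lam β x * pd κ β x
          - 2 * β x * ∑ μ, pd μ β x * W x μ + β x ^ 2 * ∑ μ, pd μ ω x * W x μ))) * hexp
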